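/- arXiv:2305.11197 — 2 statements merged into one kernel-verified Lean document; each statement's English description precedes it below -/
import Mathlib

section
/- Suppose joint distributions p^tr and p^te both satisfy 'label independent of mask given feature' and are both MAR, and their feature–label marginals agree: p^tr_{XY}(x,y) = p^te_{XY}(x,y) for all x ∈ Fin n → E and y ∈ 𝒴. Then the conditional label distribution given observed feature values and mask is invariant: for every mask m, every x₀ ∈ Fin n → E and every y ∈ 𝒴, J_{p^te}(m,x₀,y) · O_{p^tr}(m,x₀) = J_{p^tr}(m,x₀,y) · O_{p^te}(m,x₀). -/
open Finset

namespace Stmt0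

variable {n : ℕ} {E 𝒴 : Type*}

/-- Marginal of the feature. -/
def pX [Fintype E] [Fintype 𝒴] (p : (Fin n → E) × (Fin n → Bool) × 𝒴 → ℝ)
    (x : Fin n → E) : ℝ :=
  ∑ m : Fin n → Bool, ∑ y : 𝒴, p (x, m, y)

/-- Marginal of feature and mask. -/
def pXM [Fintype 𝒴] (p : (Fin n → E) × (Fin n → Bool) × 𝒴 → ℝ)
    (x : Fin n → E) (m : Fin n → Bool) : ℝ :=
  ∑ y : 𝒴, p (x, m, y)

/-- Marginal of feature and label. -/
def pXY (p : (Fin n → E) × (Fin n → Bool) × 𝒴 → ℝ)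
    (x : Fin n → E) (y : 𝒴) : ℝ :=
  ∑ m : Fin n → Bool, p (x, m, y)

/-- `x` agrees with `x'` on the coordinates observed by mask `m`. -/
def Agrees (m : Fin n → Bool) (x x' : Fin n → E) : Prop :=
  ∀ i, m i = true → x i = x' i

instance [DecidableEq E] (m : Fin n → Bool) (x x' : Fin n → E) :
    Decidable (Agrees m x x') :=
  inferInstanceAs (Decidable (∀ i, m i = true → x i = x' i))

/-- Probability of observing the values of `x₀` on mask `m`. -/
def Obs [Fintype E] [Fintype 𝒴] [DecidableEq E]
    (p : (Fin n → E) × (Fin n → Bool) × 𝒴 → ℝ)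
    (m : Fin n → Bool) (x₀ : Fin n → E) : ℝ :=
  ∑ x ∈ Finset.univ.filter (fun x => Agrees m x x₀), pXM p x m

/-- Joint of observed values, mask and label. -/
def J [Fintype E] [Fintype 𝒴] [DecidableEq E]
    (p : (Fin n → E) × (Fin n → Bool) × 𝒴 → ℝ)
    (m : Fin n → Bool) (x₀ : Fin n → E) (y : 𝒴) : ℝ :=
  ∑ x ∈ Finset.univ.filter (fun x => Agrees m x x₀), p (x, m, y)

/-- The label is independent of the mask given the (complete) feature. -/
def LabelIndepMaskGivenFeature [Fintype E] [Fintype 𝒴]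
    (p : (Fin n → E) × (Fin n → Bool) × 𝒴 → ℝ) : Prop :=
  ∀ x m y, p (x, m, y) * pX p x = pXM p x m * pXY p x y

/-- Missing at random. -/
def MAR [Fintype E] [Fintype 𝒴]
    (p : (Fin n → E) × (Fin n → Bool) × 𝒴 → ℝ) : Prop :=
  ∀ m x x', Agrees m x x' → pXM p x m * pX p x' = pXM p x' m * pX p x

lemma pX_eq_sum_pXY [Fintype E] [Fintype 𝒴] (p : (Fin n → E) × (Fin n → Bool) × 𝒴 → ℝ)
    (x : Fin n → E) : pX p x = ∑ y, pXY p x y :=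
  Finset.sum_comm

lemma eq_zero_of_pX_eq_zero [Fintype E] [Fintype 𝒴]
    {p : (Fin n → E) × (Fin n → Bool) × 𝒴 → ℝ} (hp : ∀ z, 0 ≤ p z) {x : Fin n → E}
    (hx : pX p x = 0) (m : Fin n → Bool) (y : 𝒴) : p (x, m, y) = 0 := by
  have hm := (Finset.sum_eq_zero_iff_of_nonneg
    (fun m _ => Finset.sum_nonneg fun y _ => hp (x, m, y))).1 hx m (Finset.mem_univ m)
  exact (Finset.sum_eq_zero_iff_of_nonneg (fun y _ => hp (x, m, y))).1 hm y (Finset.mem_univ y)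

/-- Under MAR, the conditional probability of a mask is constant on the features sharing the
same observed values. -/
lemma MAR.exists_pXM_eq_mul_pX [Fintype E] [Fintype 𝒴]
    {p : (Fin n → E) × (Fin n → Bool) × 𝒴 → ℝ} (hp : ∀ z, 0 ≤ p z) (hmar : MAR p)
    (m : Fin n → Bool) (x₀ : Fin n → E) :
    ∃ c : ℝ, ∀ x, Agrees m x x₀ → pXM p x m = c * pX p x := by
  by_cases h : ∃ x, Agrees m x x₀ ∧ pX p x ≠ 0
  · obtain ⟨x', hx', hne⟩ := h
    refine ⟨pXM p x' m / pX p x', fun x hx => ?_⟩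
    have hxx' := hmar m x x' fun i hi => (hx i hi).trans (hx' i hi).symm
    field_simp
    linarith
  · push Not at h
    refine ⟨0, fun x hx => ?_⟩
    rw [zero_mul]
    exact Finset.sum_eq_zero fun y _ => eq_zero_of_pX_eq_zero hp (h x hx) m y

/-- On features sharing the same observed values, the joint distribution is a constant multiple
of the feature–label marginal. -/
lemma exists_J_eq_and_Obs_eq [Fintype E] [Fintype 𝒴] [DecidableEq E]
    {p : (Fin n → E) × (Fin n → Bool) × 𝒴 → ℝ} (hp : ∀ z, 0 ≤ p z)
    (hind : LabelIndepMaskGivenFeature p) (hmar : MAR p)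
    (m : Fin n → Bool) (x₀ : Fin n → E) :
    ∃ c : ℝ, (∀ y, J p m x₀ y = c * ∑ x with Agrees m x x₀, pXY p x y) ∧
      Obs p m x₀ = c * ∑ x with Agrees m x x₀, ∑ y, pXY p x y := by
  obtain ⟨c, hc⟩ := hmar.exists_pXM_eq_mul_pX hp m x₀
  refine ⟨c, fun y => ?_, ?_⟩
  · rw [J, Finset.mul_sum]
    refine Finset.sum_congr rfl fun x hx => ?_
    by_cases h0 : pX p x = 0
    · have hXY : pXY p x y = 0 :=
        Finset.sum_eq_zero fun m _ => eq_zero_of_pX_eq_zero hp h0 m y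
      rw [hXY, mul_zero, eq_zero_of_pX_eq_zero hp h0]
    · apply mul_right_cancel₀ h0
      rw [hind, hc x (Finset.mem_filter.1 hx).2]
      ring
  · rw [Obs, Finset.mul_sum]
    refine Finset.sum_congr rfl fun x hx => ?_
    rw [hc x (Finset.mem_filter.1 hx).2, pX_eq_sum_pXY]

theorem invariant_conditional_label_distribution
    [Fintype E] [Fintype 𝒴] [Nonempty E] [Nonempty 𝒴] [DecidableEq E]
    (ptr pte : (Fin n → E) × (Fin n → Bool) × 𝒴 → ℝ)
    (htr_nonneg : ∀ z, 0 ≤ ptr z) (htr_sum : ∑ z, ptr z = 1)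
    (hte_nonneg : ∀ z, 0 ≤ pte z) (hte_sum : ∑ z, pte z = 1)
    (htr_ind : LabelIndepMaskGivenFeature ptr)
    (hte_ind : LabelIndepMaskGivenFeature pte)
    (htr_mar : MAR ptr) (hte_mar : MAR pte)
    (hXY : ∀ x y, pXY ptr x y = pXY pte x y) :
    ∀ (m : Fin n → Bool) (x₀ : Fin n → E) (y : 𝒴),
      J pte m x₀ y * Obs ptr m x₀ = J ptr m x₀ y * Obs pte m x₀ := by
  intro m x₀ y
  obtain ⟨c, hJtr, hOtr⟩ := exists_J_eq_and_Obs_eq htr_nonneg htr_ind htr_mar m x₀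
  obtain ⟨d, hJte, hOte⟩ := exists_J_eq_and_Obs_eq hte_nonneg hte_ind hte_mar m x₀
  rw [hJtr, hOtr, hJte, hOte]
  simp only [hXY]
  ring

end Stmt0
end

section
/- Suppose joint distributions p^tr and p^te both satisfy 'label independent of mask given feature' and are both MAR, their feature–label marginals agree (p^tr_{XY} = p^te_{XY}), and f : 𝒴 → ℝ is any real-valued label. Then for every mask m and every x₀ with O_{p^tr}(m,x₀) > 0 and O_{p^te}(m,x₀) > 0, the conditional expectations of the label given the observed values and mask coincide: (Σ_y f(y) · J_{p^te}(m,x₀,y)) / O_{p^te}(m,x₀) = (Σ_y f(y) · J_{p^tr}(m,x₀,y)) / O_{p^tr}(m,x₀). -/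
open Finset

namespace Stmt1

variable {n : ℕ} {E 𝒴 : Type*}

/-- Marginal of the feature. -/
def pX [Fintype E] [Fintype 𝒴] (p : (Fin n → E) × (Fin n → Bool) × 𝒴 → ℝ)
    (x : Fin n → E) : ℝ :=
  ∑ m : Fin n → Bool, ∑ y : 𝒴, p (x, m, y)

/-- Marginal of feature and mask. -/
def pXM [Fintype 𝒴] (p : (Fin n → E) × (Fin n → Bool) × 𝒴 → ℝ)
    (x : Fin n → E) (m : Fin n → Bool) : ℝ :=
  ∑ y : 𝒴, p (x, m, y)

/-- Marginal of feature and label. -/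
def pXY (p : (Fin n → E) × (Fin n → Bool) × 𝒴 → ℝ)
    (x : Fin n → E) (y : 𝒴) : ℝ :=
  ∑ m : Fin n → Bool, p (x, m, y)

/-- `x` agrees with `x'` on the coordinates observed by mask `m`. -/
def Agrees (m : Fin n → Bool) (x x' : Fin n → E) : Prop :=
  ∀ i, m i = true → x i = x' i

instance [DecidableEq E] (m : Fin n → Bool) (x x' : Fin n → E) :
    Decidable (Agrees m x x') :=
  inferInstanceAs (Decidable (∀ i, m i = true → x i = x' i))

/-- Probability of observing the values of `x₀` on mask `m`. -/
def Obs [Fintype E] [Fintype 𝒴] [DecidableEq E]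
    (p : (Fin n → E) × (Fin n → Bool) × 𝒴 → ℝ)
    (m : Fin n → Bool) (x₀ : Fin n → E) : ℝ :=
  ∑ x ∈ Finset.univ.filter (fun x => Agrees m x x₀), pXM p x m

/-- Joint of observed values, mask and label. -/
def J [Fintype E] [Fintype 𝒴] [DecidableEq E]
    (p : (Fin n → E) × (Fin n → Bool) × 𝒴 → ℝ)
    (m : Fin n → Bool) (x₀ : Fin n → E) (y : 𝒴) : ℝ :=
  ∑ x ∈ Finset.univ.filter (fun x => Agrees m x x₀), p (x, m, y)

/-- The label is independent of the mask given the (complete) feature. -/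
def LabelIndepMaskGivenFeature [Fintype E] [Fintype 𝒴]
    (p : (Fin n → E) × (Fin n → Bool) × 𝒴 → ℝ) : Prop :=
  ∀ x m y, p (x, m, y) * pX p x = pXM p x m * pXY p x y

/-- Missing at random. -/
def MAR [Fintype E] [Fintype 𝒴]
    (p : (Fin n → E) × (Fin n → Bool) × 𝒴 → ℝ) : Prop :=
  ∀ m x x', Agrees m x x' → pXM p x m * pX p x' = pXM p x' m * pX p x

theorem Agrees.trans_symm {m : Fin n → Bool} {x x' x₀ : Fin n → E}
    (h : Agrees m x x₀) (h' : Agrees m x' x₀) : Agrees m x x' :=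
  fun i hi => (h i hi).trans (h' i hi).symm

theorem pX_eq_sum_pXY [Fintype E] [Fintype 𝒴]
    (p : (Fin n → E) × (Fin n → Bool) × 𝒴 → ℝ) (x : Fin n → E) :
    pX p x = ∑ y, pXY p x y :=
  Finset.sum_comm

theorem pXM_le_pX [Fintype E] [Fintype 𝒴]
    {p : (Fin n → E) × (Fin n → Bool) × 𝒴 → ℝ} (hp : ∀ z, 0 ≤ p z)
    (x : Fin n → E) (m : Fin n → Bool) : pXM p x m ≤ pX p x :=
  Finset.single_le_sum (f := fun m => ∑ y, p (x, m, y))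
    (fun _ _ => Finset.sum_nonneg fun _ _ => hp _) (Finset.mem_univ m)

theorem pXY_eq_zero_of_pX_eq_zero [Fintype E] [Fintype 𝒴]
    {p : (Fin n → E) × (Fin n → Bool) × 𝒴 → ℝ} (hp : ∀ z, 0 ≤ p z)
    {x : Fin n → E} (hx : pX p x = 0) (y : 𝒴) : pXY p x y = 0 := by
  rw [pX_eq_sum_pXY] at hx
  exact (Finset.sum_eq_zero_iff_of_nonneg fun _ _ => Finset.sum_nonneg fun _ _ => hp _).mp hx y
    (Finset.mem_univ y)

theorem apply_eq_zero_of_pX_eq_zero [Fintype E] [Fintype 𝒴]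
    {p : (Fin n → E) × (Fin n → Bool) × 𝒴 → ℝ} (hp : ∀ z, 0 ≤ p z)
    {x : Fin n → E} (hx : pX p x = 0) (m : Fin n → Bool) (y : 𝒴) : p (x, m, y) = 0 := by
  have h := pXY_eq_zero_of_pX_eq_zero hp hx y
  rw [pXY, Finset.sum_eq_zero_iff_of_nonneg (fun _ _ => hp _)] at h
  exact h m (Finset.mem_univ m)

/-- Under MAR, the mask carries no information on the feature beyond the observed values. -/
theorem MAR.pXM_mul_sum_pX [Fintype E] [Fintype 𝒴] [DecidableEq E]
    {p : (Fin n → E) × (Fin n → Bool) × 𝒴 → ℝ} (hmar : MAR p)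
    {m : Fin n → Bool} {x x₀ : Fin n → E} (hx : Agrees m x x₀) :
    pXM p x m * ∑ x' ∈ Finset.univ.filter (fun x' => Agrees m x' x₀), pX p x' =
      Obs p m x₀ * pX p x := by
  rw [Obs, Finset.mul_sum, Finset.sum_mul]
  exact Finset.sum_congr rfl fun x' hx' =>
    hmar m x x' (hx.trans_symm (Finset.mem_filter.mp hx').2)

/-- The label and the mask are independent given the observed values. -/
theorem J_mul_sum_pX [Fintype E] [Fintype 𝒴] [DecidableEq E]
    {p : (Fin n → E) × (Fin n → Bool) × 𝒴 → ℝ} (hp : ∀ z, 0 ≤ p z)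
    (hind : LabelIndepMaskGivenFeature p) (hmar : MAR p)
    (m : Fin n → Bool) (x₀ : Fin n → E) (y : 𝒴) :
    J p m x₀ y * ∑ x ∈ Finset.univ.filter (fun x => Agrees m x x₀), pX p x =
      Obs p m x₀ * ∑ x ∈ Finset.univ.filter (fun x => Agrees m x x₀), pXY p x y := by
  rw [J, Finset.sum_mul, Finset.mul_sum]
  refine Finset.sum_congr rfl fun x hx => ?_
  by_cases h0 : pX p x = 0
  · rw [apply_eq_zero_of_pX_eq_zero hp h0, pXY_eq_zero_of_pX_eq_zero hp h0, zero_mul, mul_zero]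
  · apply mul_right_cancel₀ h0
    linear_combination
      (∑ x' ∈ Finset.univ.filter (fun x' => Agrees m x' x₀), pX p x') * hind x m y +
        pXY p x y * hmar.pXM_mul_sum_pX (Finset.mem_filter.mp hx).2

/-- The conditional expectation of the label is determined by the feature-label marginal. -/
theorem conditional_expectation_eq [Fintype E] [Fintype 𝒴] [DecidableEq E]
    {p : (Fin n → E) × (Fin n → Bool) × 𝒴 → ℝ} (hp : ∀ z, 0 ≤ p z)
    (hind : LabelIndepMaskGivenFeature p) (hmar : MAR p) (f : 𝒴 → ℝ)
    {m : Fin n → Bool} {x₀ : Fin n → E} (hO : 0 < Obs p m x₀) :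
    (∑ y, f y * J p m x₀ y) / Obs p m x₀ =
      (∑ y, f y * ∑ x ∈ Finset.univ.filter (fun x => Agrees m x x₀), pXY p x y) /
        ∑ x ∈ Finset.univ.filter (fun x => Agrees m x x₀), ∑ y, pXY p x y := by
  simp_rw [← pX_eq_sum_pXY]
  have hW : 0 < ∑ x ∈ Finset.univ.filter (fun x => Agrees m x x₀), pX p x :=
    hO.trans_le (Finset.sum_le_sum fun x _ => pXM_le_pX hp x m)
  rw [div_eq_div_iff hO.ne' hW.ne', Finset.sum_mul, Finset.sum_mul]
  refine Finset.sum_congr rfl fun y _ => ?_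
  linear_combination f y * J_mul_sum_pX hp hind hmar m x₀ y

theorem invariant_conditional_expectation
    [Fintype E] [Fintype 𝒴] [Nonempty E] [Nonempty 𝒴] [DecidableEq E]
    (ptr pte : (Fin n → E) × (Fin n → Bool) × 𝒴 → ℝ)
    (htr_nonneg : ∀ z, 0 ≤ ptr z) (htr_sum : ∑ z, ptr z = 1)
    (hte_nonneg : ∀ z, 0 ≤ pte z) (hte_sum : ∑ z, pte z = 1)
    (htr_ind : LabelIndepMaskGivenFeature ptr)
    (hte_ind : LabelIndepMaskGivenFeature pte)
    (htr_mar : MAR ptr) (hte_mar : MAR pte)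
    (hXY : ∀ x y, pXY ptr x y = pXY pte x y)
    (f : 𝒴 → ℝ) :
    ∀ (m : Fin n → Bool) (x₀ : Fin n → E),
      0 < Obs ptr m x₀ → 0 < Obs pte m x₀ →
      (∑ y : 𝒴, f y * J pte m x₀ y) / Obs pte m x₀
        = (∑ y : 𝒴, f y * J ptr m x₀ y) / Obs ptr m x₀ := by
  intro m x₀ htr hte
  rw [conditional_expectation_eq hte_nonneg hte_ind hte_mar f hte,
    conditional_expectation_eq htr_nonneg htr_ind htr_mar f htr]
  simp_rw [hXY]

end Stmt1
end
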